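/- Let f* : D → C be a coproduct-preserving tensor-exact functor between rigidly-compactly generated tensor-triangulated categories satisfying Grothendieck-Neeman duality (i.e. its right adjoint f_* preserves compact objects), and let ω := f^(1)(𝟙) be the relative dualizing object. Then f_*(ω) is a compact object of D. Moreover, ω is compact in C if and only if ω is ⊗-invertible in C. -/

import Mathlib

/-!
Formalization of statements from "Grothendieck-Neeman duality and the
Wirthmüller isomorphism" by Balmer, Dell'Ambrogio and Sanders.
-/

noncomputable section

open CategoryTheory CategoryTheory.Limits CategoryTheory.Pretriangulated
  CategoryTheory.MonoidalCategory CategoryTheory.MonoidalClosed Opposite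

universe v u u₁ u₂ u₃

namespace GN

section Compact

variable {C : Type u} [Category.{v} C]

/-- An object `t` is compact if `Hom(t, -)`, viewed as a functor to abelian groups,
preserves small coproducts. -/
def IsCompactObj [Preadditive C] (t : C) : Prop :=
  ∀ J : Type v, Nonempty (PreservesColimitsOfShape (Discrete J)
    (preadditiveCoyoneda.obj (op t)))

/-- A functor preserves arbitrary (small) coproducts. -/
def PreservesCoproducts {D : Type u₂} [Category.{v} D] (F : C ⥤ D) : Prop :=
  ∀ J : Type v, Nonempty (PreservesColimitsOfShape (Discrete J) F)

/-- A functor preserves arbitrary (small) products. -/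
def PreservesProducts {D : Type u₂} [Category.{v} D] (F : C ⥤ D) : Prop :=
  ∀ J : Type v, Nonempty (PreservesLimitsOfShape (Discrete J) F)

/-- A compactly generated category: it admits all small coproducts and
has a set of compact generators. -/
structure CompactlyGenerated (C : Type u) [Category.{v} C] [Preadditive C] : Prop where
  hasCoproducts : HasCoproducts.{v} C
  exists_generators : ∃ (ι : Type v) (G : ι → C), (∀ i, IsCompactObj (G i)) ∧
    ∀ t : C, (∀ (i : ι) (f : G i ⟶ t), f = 0) → IsZero t

end Compact

section Tensor

variable {C : Type u} [Category.{v} C] [MonoidalCategory C] [MonoidalClosed C]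

/-- The canonical map `hom(x,𝟙) ⊗ y ⟶ hom(x,y)`. -/
def rigidComparison (x y : C) : (ihom x).obj (𝟙_ C) ⊗ y ⟶ (ihom x).obj y :=
  MonoidalClosed.curry ((α_ x ((ihom x).obj (𝟙_ C)) y).inv ≫
    (((ihom.ev x).app (𝟙_ C)) ▷ y) ≫ (λ_ y).hom)

/-- An object `x` is rigid if `hom(x,𝟙) ⊗ y ⟶ hom(x,y)` is an isomorphism for all `y`. -/
def IsRigid (x : C) : Prop := ∀ y : C, IsIso (rigidComparison x y)

/-- An object `u` is `⊗`-invertible if `u ⊗ v ≅ 𝟙` for some `v`. -/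
def TensorInvertible (u : C) : Prop := ∃ v : C, Nonempty (u ⊗ v ≅ 𝟙_ C)

/-- The `κ`-twisted duality functor `D_κ = hom(-,κ)`. -/
@[reducible] def Dfun (κ : C) : Cᵒᵖ ⥤ C := MonoidalClosed.internalHom.flip.obj κ

/-- The canonical double-duality map `ϖ : x ⟶ D_κ D_κ (x)`, i.e. the unit/counit of the
self-adjunction of `D_κ = hom(-,κ)`. -/
def varpi [BraidedCategory C] (κ x : C) : x ⟶ (ihom ((ihom x).obj κ)).obj κ :=
  MonoidalClosed.curry ((β_ ((ihom x).obj κ) x).hom ≫ (ihom.ev x).app κ)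

/-- A rigidly-compactly generated tensor-triangulated category: it admits all small
coproducts, its compact objects coincide with its rigid objects, and it has a set of
compact generators. -/
structure RigidlyCompactlyGenerated (C : Type u) [Category.{v} C] [Preadditive C]
    [MonoidalCategory C] [MonoidalClosed C] : Prop where
  hasCoproducts : HasCoproducts.{v} C
  compact_iff_rigid : ∀ x : C, IsCompactObj x ↔ IsRigid x
  exists_generators : ∃ (ι : Type v) (G : ι → C), (∀ i, IsCompactObj (G i)) ∧
    ∀ t : C, (∀ (i : ι) (f : G i ⟶ t), f = 0) → IsZero t

end Tensor

section Triang

variable {C : Type u} [Category.{v} C] [HasZeroObject C] [Preadditive C] [HasShift C ℤ]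
  [∀ n : ℤ, (shiftFunctor C n).Additive] [Pretriangulated C]

/-- A thick triangulated subcategory, given as a predicate on objects:
it contains the zero objects, and is closed under shifts, cones and direct summands
(hence in particular under isomorphisms). -/
structure IsThickSubcategory (S : Set C) : Prop where
  zero : ∀ x : C, IsZero x → x ∈ S
  shift : ∀ x ∈ S, ∀ n : ℤ, x⟦n⟧ ∈ S
  ext₃ : ∀ T : Triangle C, (T ∈ distTriang C) → T.obj₁ ∈ S → T.obj₂ ∈ S → T.obj₃ ∈ S
  retract : ∀ x y : C, (∃ (s : x ⟶ y) (r : y ⟶ x), s ≫ r = 𝟙 x) → y ∈ S → x ∈ S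

/-- The thick subcategory generated by a set of objects. -/
def thickClosure (S : Set C) : Set C :=
  { x | ∀ T : Set C, IsThickSubcategory T → S ⊆ T → x ∈ T }

/-- A `C^c`-submodule of `C`: a thick triangulated subcategory which is closed under
tensoring with compact objects. -/
structure IsSubmodule [MonoidalCategory C] (S : Set C) extends IsThickSubcategory S : Prop where
  smul : ∀ c x : C, IsCompactObj c → x ∈ S → (c ⊗ x) ∈ S

end Triang

section Dual

variable {C : Type u} [Category.{v} C] [MonoidalCategory C] [BraidedCategory C]
  [MonoidalClosed C]

/-- `κ` is a (possibly external) dualizing object for `S ⊆ C`: the `κ`-twisted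
duality `D_κ = hom(-,κ)` preserves `S` and every object of `S` is `κ`-reflexive;
equivalently, `D_κ` restricts to an anti-equivalence `S^op ≃ S`. -/
structure IsExternalDualizing (S : Set C) (κ : C) : Prop where
  stable : ∀ x ∈ S, (ihom x).obj κ ∈ S
  reflexive : ∀ x ∈ S, IsIso (varpi κ x)

/-- `κ ∈ S` is a dualizing object for `S`. -/
structure IsDualizing (S : Set C) (κ : C) extends IsExternalDualizing S κ : Prop where
  mem : κ ∈ S

end Dual

section Pullback

variable {C : Type u₁} {D : Type u₂} [Category.{v} C] [Category.{v} D]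
  [Preadditive C] [MonoidalCategory C]

/-- The compact pull-back `f^#(D₀)` of a subcategory `D₀ ⊆ D` along `f_* : C ⥤ D`. -/
def compactPullback (fpush : C ⥤ D) (D₀ : Set D) : Set C :=
  { x | ∀ c : C, IsCompactObj c → fpush.obj (c ⊗ x) ∈ D₀ }

end Pullback

section Proj

variable {D : Type u₁} {C : Type u₂} [Category.{v} D] [Category.{v} C]
  [MonoidalCategory D] [MonoidalCategory C]

/-- The canonical projection formula map `π : x ⊗ f_*(y) ⟶ f_*(f^*(x) ⊗ y)`,
obtained by adjunction from `f^*(x ⊗ f_* y) ≅ f^* x ⊗ f^* f_* y → f^* x ⊗ y`. -/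
def projFormula (fstar : D ⥤ C) [fstar.Monoidal] (fpush : C ⥤ D) (adj : fstar ⊣ fpush)
    (x : D) (y : C) : x ⊗ fpush.obj y ⟶ fpush.obj (fstar.obj x ⊗ y) :=
  (adj.homEquiv _ _)
    (Functor.OplaxMonoidal.δ fstar x (fpush.obj y) ≫ (fstar.obj x ◁ adj.counit.app y))

/-- The canonical comparison map `f^(1)(x) ⊗ f^*(y) ⟶ f^(1)(x ⊗ y)`, obtained by
adjunction from the counit `f_* f^(1) → Id` via the projection formula. -/
def gnComparison [BraidedCategory D] [BraidedCategory C] (fstar : D ⥤ C) [fstar.Monoidal]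
    (fpush : C ⥤ D) (adj1 : fstar ⊣ fpush) (fone : D ⥤ C) (adj2 : fpush ⊣ fone)
    (hπ : ∀ (x : D) (y : C), IsIso (projFormula fstar fpush adj1 x y)) (x y : D) :
    fone.obj x ⊗ fstar.obj y ⟶ fone.obj (x ⊗ y) :=
  haveI := hπ y (fone.obj x)
  (adj2.homEquiv _ _)
    (fpush.map (β_ (fone.obj x) (fstar.obj y)).hom ≫
      inv (projFormula fstar fpush adj1 y (fone.obj x)) ≫
      (β_ y (fpush.obj (fone.obj x))).hom ≫ (adj2.counit.app x ▷ y))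

end Proj


lemma isCompactObj_leftAdjoint {C : Type u₁} {D : Type u₂} [Category.{v} C] [Category.{v} D]
    [Preadditive C] [Preadditive D] {L : C ⥤ D} {R : D ⥤ C} (adj : L ⊣ R) [R.Additive]
    (hR : PreservesCoproducts R) {t : C} (ht : IsCompactObj t) : IsCompactObj (L.obj t) := by
  intro J
  obtain ⟨_⟩ := hR J
  obtain ⟨_⟩ := ht J
  have : L.Additive := adj.left_adjoint_additive
  refine ⟨preservesColimitsOfShape_of_natIso
    (F := R ⋙ preadditiveCoyoneda.obj (op t)) (NatIso.ofComponents
      (fun X => (AddEquiv.toAddCommGrpIso (adj.homAddEquiv t X).symm)) ?_)⟩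
  intro X Y f
  ext g
  exact adj.homEquiv_naturality_right_symm g f

lemma isCompactObj_of_iso {C : Type u₁} [Category.{v} C]
    [Preadditive C] {s t : C} (e : s ≅ t) (ht : IsCompactObj t) : IsCompactObj s := by
  intro J
  obtain ⟨_⟩ := ht J
  exact ⟨preservesColimitsOfShape_of_natIso (preadditiveCoyoneda.mapIso e.op)⟩

lemma isCompactObj_shift {C : Type u} [Category.{v} C] [Preadditive C] [HasShift C ℤ]
    [∀ n : ℤ, (shiftFunctor C n).Additive] {t : C} (ht : IsCompactObj t) (n : ℤ) :
    IsCompactObj (t⟦n⟧) :=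
  isCompactObj_leftAdjoint (R := shiftFunctor C (-n)) (shiftEquiv C n).toAdjunction
    (fun _ => ⟨inferInstance⟩) ht

/-- A morphism inducing bijections on maps out of all compact objects is an isomorphism. -/
lemma isIso_of_bijective_comp {C : Type u} [Category.{v} C] [HasZeroObject C] [Preadditive C]
    [HasShift C ℤ] [∀ n : ℤ, (shiftFunctor C n).Additive] [Pretriangulated C]
    {ι : Type v} {G : ι → C} (hG : ∀ i, IsCompactObj (G i))
    (hG0 : ∀ t : C, (∀ (i : ι) (f : G i ⟶ t), f = 0) → IsZero t) {a b : C} (φ : a ⟶ b)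
    (hφ : ∀ t : C, IsCompactObj t → Function.Bijective (fun g : t ⟶ a => g ≫ φ)) : IsIso φ := by
  obtain ⟨c, g, h, mem⟩ := distinguished_cocone_triangle φ
  refine (Triangle.isZero₃_iff_isIso₁ _ mem).1 (hG0 _ fun i f => ?_)
  have hinj (k : G i ⟶ a⟦(1 : ℤ)⟧) (hk : k ≫ φ⟦(1 : ℤ)⟧' = 0) : k = 0 := by
    let adj : shiftFunctor C (-1 : ℤ) ⊣ shiftFunctor C (1 : ℤ) :=
      (shiftEquiv' C (-1 : ℤ) 1 (by simp)).toAdjunction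
    apply (adj.homEquiv _ _).symm.injective
    apply (hφ _ (isCompactObj_shift (hG i) (-1))).1
    have := adj.homEquiv_naturality_right_symm k φ
    rw [hk] at this
    simp only [← this]
    simp
  change G i ⟶ c at f
  have h0 : f ≫ h = 0 := hinj _ (by
    rw [Category.assoc]
    exact (f ≫= comp_distTriang_mor_zero₃₁ _ mem).trans comp_zero)
  obtain ⟨u, rfl⟩ := Triangle.coyoneda_exact₃ _ mem f h0
  obtain ⟨w, rfl⟩ := (hφ _ (hG i)).2 u
  exact (Category.assoc _ _ _).trans ((w ≫= comp_distTriang_mor_zero₁₂ _ mem).trans comp_zero)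

section

variable {C : Type u} [Category.{v} C] [MonoidalCategory C]

lemma exactPairing_bijective (x y : C) [ExactPairing x y] :
    Function.Bijective (fun g : 𝟙_ C ⟶ y => (λ_ x).inv ≫ g ▷ x ≫ ε_ x y) := by
  have := ((Iso.homToEquiv (λ_ y).symm).trans
    ((tensorRightHomEquiv (𝟙_ C) x y (𝟙_ C)).symm.trans
      (Iso.homFromEquiv (λ_ x)))).bijective
  convert this using 2 with g
  simp [tensorRightHomEquiv, ← unitors_equal]

/-- If one zigzag identity holds for a pairing with values in `𝟙` and this pairing is
universal, then the other zigzag identity holds after pairing. -/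
lemma whiskerLeft_zigzag_comp {x d : C} (coev : 𝟙_ C ⟶ d ⊗ x) (ev : x ⊗ d ⟶ 𝟙_ C)
    (h : x ◁ coev ≫ (α_ x d x).inv ≫ ev ▷ x = (ρ_ x).hom ≫ (λ_ x).inv) :
    x ◁ (coev ▷ d ≫ (α_ d x d).hom ≫ d ◁ ev ≫ (ρ_ d).hom) ≫ ev = x ◁ (λ_ d).hom ≫ ev := by
  calc
    _ = 𝟙 _ ⊗≫ (x ◁ coev) ▷ d ⊗≫ ((x ⊗ d) ◁ ev ≫ ev ▷ 𝟙_ C) ⊗≫ 𝟙 _ := by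
      monoidal
    _ = 𝟙 _ ⊗≫ (x ◁ coev ≫ (α_ _ _ _).inv ≫ ev ▷ x) ▷ d ⊗≫ 𝟙_ C ◁ ev ⊗≫ 𝟙 _ := by
      rw [whisker_exchange]; monoidal
    _ = 𝟙 _ ⊗≫ ((ρ_ x).hom ≫ (λ_ x).inv) ▷ d ⊗≫ 𝟙_ C ◁ ev ⊗≫ 𝟙 _ := by
      rw [h]
    _ = _ := by monoidal

variable [MonoidalClosed C]

lemma whiskerLeft_rigidComparison (x y : C) {z : C} (f : z ⟶ (ihom x).obj (𝟙_ C) ⊗ y) :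
    uncurry (f ≫ rigidComparison x y) = x ◁ f ≫ (α_ x ((ihom x).obj (𝟙_ C)) y).inv ≫
    (((ihom.ev x).app (𝟙_ C)) ▷ y) ≫ (λ_ y).hom := by
  rw [uncurry_natural_left, rigidComparison, uncurry_curry]

/-- The coevaluation `𝟙 ⟶ hom(x, 𝟙) ⊗ x` of a rigid object. -/
def rigidCoevaluation (x : C) [IsIso (rigidComparison x x)] : 𝟙_ C ⟶ (ihom x).obj (𝟙_ C) ⊗ x :=
  curry (ρ_ x).hom ≫ inv (rigidComparison x x)

lemma whiskerLeft_rigidCoevaluation_comp (x : C) [IsIso (rigidComparison x x)] :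
    x ◁ rigidCoevaluation x ≫ (α_ x ((ihom x).obj (𝟙_ C)) x).inv ≫
      (ihom.ev x).app (𝟙_ C) ▷ x = (ρ_ x).hom ≫ (λ_ x).inv := by
  have := whiskerLeft_rigidComparison x x (rigidCoevaluation x)
  rw [rigidCoevaluation, Category.assoc, IsIso.inv_hom_id, Category.comp_id, uncurry_curry] at this
  rw [Iso.eq_comp_inv, this, rigidCoevaluation]
  simp

/-- A rigid object is paired exactly with its dual `hom(x, 𝟙)` by evaluation. -/
@[reducible] def IsRigid.exactPairing {x : C} (hx : IsRigid x) :
    ExactPairing ((ihom x).obj (𝟙_ C)) x :=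
  haveI := hx x
  { coevaluation' := rigidCoevaluation x
    evaluation' := (ihom.ev x).app (𝟙_ C)
    coevaluation_evaluation' := whiskerLeft_rigidCoevaluation_comp x
    evaluation_coevaluation' := by
      rw [← cancel_mono (ρ_ _).hom]
      apply uncurry_injective
      simpa [uncurry_eq] using
        whiskerLeft_zigzag_comp _ _ (whiskerLeft_rigidCoevaluation_comp x) }

lemma isRigid_tensorUnit : IsRigid (𝟙_ C) := by
  intro y
  have : (tensorLeft (𝟙_ C)).IsEquivalence :=
    Functor.isEquivalence_of_iso (leftUnitorNatIso C).symm
  have : (ihom (𝟙_ C)).IsEquivalence :=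
    (ihom.adjunction (𝟙_ C)).isEquivalence_right_of_isEquivalence_left
  have h1 : IsIso (ihom.adjunction (𝟙_ C)).counit := inferInstance
  have h2 : IsIso (ihom.adjunction (𝟙_ C)).unit := inferInstance
  have h3 : IsIso ((ihom.ev (𝟙_ C)).app (𝟙_ C)) :=
    inferInstanceAs (IsIso ((ihom.adjunction (𝟙_ C)).counit.app _))
  have h4 : IsIso ((ihom.coev (𝟙_ C)).app ((ihom (𝟙_ C)).obj (𝟙_ C) ⊗ y)) :=
    inferInstanceAs (IsIso ((ihom.adjunction (𝟙_ C)).unit.app _))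
  rw [rigidComparison, curry_eq]
  infer_instance

end

lemma additive_of_adjunction {C : Type u₁} {D : Type u₂} [Category.{v} C] [Category.{v} D]
    [Preadditive C] [Preadditive D] [HasBinaryProducts D] [HasZeroObject D]
    {L : C ⥤ D} {R : D ⥤ C} (adj : L ⊣ R) : R.Additive := by
  have := adj.rightAdjoint_preservesLimits.{0, 0}
  have := adj.isRightAdjoint
  exact Functor.additive_of_preserves_binary_products R

section

variable {C : Type u} [Category.{v} C] [Preadditive C] [HasZeroObject C] [HasBinaryProducts C]
  [MonoidalCategory C] [MonoidalClosed C]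

lemma isCompactObj_of_exactPairing (h : IsCompactObj (𝟙_ C)) (x y : C) [ExactPairing x y] :
    IsCompactObj y := by
  have adj := tensorLeftAdjunction x y
  have := additive_of_adjunction adj
  exact isCompactObj_of_iso (ρ_ y).symm
    (isCompactObj_leftAdjoint adj (fun _ => ⟨inferInstance⟩) h)

lemma isCompactObj_of_tensorInvertible [BraidedCategory C] (h : IsCompactObj (𝟙_ C)) {u : C}
    (hu : TensorInvertible u) : IsCompactObj u := by
  obtain ⟨w, ⟨i⟩⟩ := hu
  let e : C ≌ C := .mk (tensorLeft u) (tensorLeft w)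
    ((leftUnitorNatIso C).symm ≪≫ (tensoringLeft C).mapIso (i.symm ≪≫ β_ u w) ≪≫
      tensorLeftTensor w u)
    ((tensorLeftTensor u w).symm ≪≫ (tensoringLeft C).mapIso i ≪≫ leftUnitorNatIso C)
  have adj : tensorLeft u ⊣ tensorLeft w := e.toAdjunction
  have := additive_of_adjunction adj
  exact isCompactObj_of_iso (ρ_ u).symm
    (isCompactObj_leftAdjoint adj (fun _ => ⟨inferInstance⟩) h)

end

section

open Functor.LaxMonoidal Functor.OplaxMonoidal

variable {D : Type u₁} {C : Type u₂} [Category.{v} D] [Category.{v} C]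
  [MonoidalCategory D] [MonoidalCategory C]

/-- A monoidal functor sends exact pairings to exact pairings. -/
@[reducible] def mapExactPairing (F : D ⥤ C) [F.Monoidal] (s t : D) [ExactPairing s t] :
    ExactPairing (F.obj s) (F.obj t) where
  coevaluation' := ε F ≫ F.map (η_ s t) ≫ δ F s t
  evaluation' := μ F t s ≫ F.map (ε_ s t) ≫ η F
  coevaluation_evaluation' := by
    have := F.congr_map (ExactPairing.coevaluation_evaluation s t)
    simp only [Functor.map_comp, Functor.Monoidal.map_whiskerLeft,
      Functor.Monoidal.map_whiskerRight, Functor.Monoidal.map_associator_inv,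
      Functor.Monoidal.map_rightUnitor, Functor.Monoidal.map_leftUnitor_inv, Category.assoc,
      Functor.Monoidal.μ_δ_assoc, cancel_epi] at this
    rw [← cancel_epi (F.obj t ◁ η F), ← cancel_mono (ε F ▷ F.obj t ≫ μ F (𝟙_ D) t)]
    simp only [Category.assoc, MonoidalCategory.whiskerLeft_comp, comp_whiskerRight,
      Functor.Monoidal.whiskerLeft_η_ε_assoc, Functor.Monoidal.whiskerRight_η_ε_assoc, this]
  evaluation_coevaluation' := by
    have := F.congr_map (ExactPairing.evaluation_coevaluation s t)
    simp only [Functor.map_comp, Functor.Monoidal.map_whiskerLeft,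
      Functor.Monoidal.map_whiskerRight, Functor.Monoidal.map_associator,
      Functor.Monoidal.map_rightUnitor_inv, Functor.Monoidal.map_leftUnitor, Category.assoc,
      Functor.Monoidal.μ_δ_assoc, cancel_epi] at this
    rw [← cancel_epi (η F ▷ F.obj s), ← cancel_mono (F.obj s ◁ ε F ≫ μ F s (𝟙_ D))]
    simp only [Category.assoc, MonoidalCategory.whiskerLeft_comp, comp_whiskerRight,
      Functor.Monoidal.whiskerLeft_η_ε_assoc, Functor.Monoidal.whiskerRight_η_ε_assoc, this]

lemma whiskerRight_whiskerRight_comp_rightUnitor {y z s t : C} (e : z ⟶ y)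
    (m : t ⊗ s ⟶ 𝟙_ C) :
    e ▷ t ▷ s ≫ (α_ y t s).hom ≫ y ◁ m ≫ (ρ_ y).hom =
      (α_ z t s).hom ≫ z ◁ m ≫ (ρ_ z).hom ≫ e := by
  rw [associator_naturality_left_assoc, ← whisker_exchange_assoc, rightUnitor_naturality]

variable (fstar : D ⥤ C) [fstar.Monoidal] (fpush : C ⥤ D) (adj : fstar ⊣ fpush)

/-- The projection formula map `f_*(y) ⊗ t ⟶ f_*(y ⊗ f^*(t))`. -/
def projFormulaRight (y : C) (t : D) : fpush.obj y ⊗ t ⟶ fpush.obj (y ⊗ fstar.obj t) :=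
  adj.homEquiv _ _ (δ fstar (fpush.obj y) t ≫ adj.counit.app y ▷ fstar.obj t)

lemma projFormulaRight_naturality (y : C) {s t : D} (a : s ⟶ t) :
    fpush.obj y ◁ a ≫ projFormulaRight fstar fpush adj y t =
      projFormulaRight fstar fpush adj y s ≫ fpush.map (y ◁ fstar.map a) := by
  simp only [projFormulaRight, ← Adjunction.homEquiv_naturality_left,
    ← Adjunction.homEquiv_naturality_right]
  rw [← δ_natural_right_assoc, Category.assoc, whisker_exchange]
  rfl

lemma homEquiv_symm_comp_projFormulaRight (y : C) {s t : D} (a : s ⟶ fpush.obj y ⊗ t) :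
    (adj.homEquiv _ _).symm (a ≫ projFormulaRight fstar fpush adj y t) =
      fstar.map a ≫ δ fstar (fpush.obj y) t ≫ adj.counit.app y ▷ fstar.obj t := by
  simp [projFormulaRight, Adjunction.homEquiv_naturality_left_symm]

lemma isIso_projFormulaRight (y : C) (s t : D) [ExactPairing s t] :
    IsIso (projFormulaRight fstar fpush adj y t) := by
  let := mapExactPairing fstar s t
  refine isIso_of_yoneda_map_bijective _ fun r => ?_
  have h₁ := ((tensorRightHomEquiv r s t (fpush.obj y)).symm.trans
    ((adj.homEquiv _ _).symm.trans
      (Iso.homFromEquiv (Functor.Monoidal.μIso fstar r s).symm))).bijective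
  have h₂ := ((adj.homEquiv _ _).symm.trans
    (tensorRightHomEquiv (fstar.obj r) (fstar.obj s) (fstar.obj t) y).symm).bijective
  refine (Function.Bijective.of_comp_iff' h₂ _).1 ?_
  convert h₁ using 1
  ext a
  simp only [Function.comp_apply, Equiv.trans_apply, homEquiv_symm_comp_projFormulaRight]
  have hε : ε_ (fstar.obj s) (fstar.obj t) = μ fstar t s ≫ fstar.map (ε_ s t) ≫ η fstar := rfl
  simp only [tensorRightHomEquiv, Adjunction.homEquiv_counit, Iso.homFromEquiv_apply,
    Equiv.coe_fn_symm_mk, Iso.symm_inv, Functor.Monoidal.μIso_hom, Functor.map_comp,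
    Functor.Monoidal.map_whiskerRight, Functor.Monoidal.map_whiskerLeft,
    Functor.Monoidal.map_associator, Functor.Monoidal.map_rightUnitor, Category.assoc,
    Functor.Monoidal.μ_δ_assoc, comp_whiskerRight, hε,
    MonoidalCategory.whiskerLeft_comp]
  congr 2
  have := whiskerRight_whiskerRight_comp_rightUnitor (adj.counit.app y)
    (μ fstar t s ≫ fstar.map (ε_ s t) ≫ η fstar)
  simp only [MonoidalCategory.whiskerLeft_comp, Category.assoc] at this
  exact this

lemma homEquiv_whiskerRight_comp_projFormulaRight {y : C} (g : 𝟙_ C ⟶ y) (t : D) :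
    (λ_ t).inv ≫ adj.homEquiv _ _ (η fstar ≫ g) ▷ t ≫ projFormulaRight fstar fpush adj y t =
      adj.homEquiv _ _ ((λ_ (fstar.obj t)).inv ≫ g ▷ fstar.obj t) := by
  rw [← Category.assoc]
  apply (adj.homEquiv _ _).symm.injective
  rw [homEquiv_symm_comp_projFormulaRight, Equiv.symm_apply_apply, Functor.map_comp,
    Category.assoc, ← δ_natural_left_assoc, Functor.Monoidal.map_leftUnitor_inv]
  have := (adj.homEquiv_counit _ _ _).symm.trans
    ((adj.homEquiv (𝟙_ D) y).symm_apply_apply (η fstar ≫ g))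
  simp only [Category.assoc, Functor.Monoidal.μ_δ_assoc]
  rw [← comp_whiskerRight, this]
  simp

end

section

variable {C : Type u} [Category.{v} C] [MonoidalCategory C] [MonoidalClosed C]

/-- Evaluation `hom(y, z) ⟶ z` at a global element of `y`. -/
def evalAt {y : C} (g : 𝟙_ C ⟶ y) (z : C) : (ihom y).obj z ⟶ z :=
  (λ_ _).inv ≫ g ▷ _ ≫ (ihom.ev y).app z

lemma comp_evalAt {y z w : C} (g : 𝟙_ C ⟶ y) (k : w ⟶ (ihom y).obj z) :
    k ≫ evalAt g z = (λ_ w).inv ≫ g ▷ w ≫ uncurry k := by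
  rw [evalAt, uncurry_eq, leftUnitor_inv_naturality_assoc, whisker_exchange_assoc]

instance isIso_evalAt_id (z : C) : IsIso (evalAt (𝟙 (𝟙_ C)) z) := by
  have : (tensorLeft (𝟙_ C)).IsEquivalence :=
    Functor.isEquivalence_of_iso (leftUnitorNatIso C).symm
  have : (ihom (𝟙_ C)).IsEquivalence :=
    (ihom.adjunction (𝟙_ C)).isEquivalence_right_of_isEquivalence_left
  have : IsIso ((ihom.ev (𝟙_ C)).app z) :=
    inferInstanceAs (IsIso ((ihom.adjunction (𝟙_ C)).counit.app _))
  rw [evalAt]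
  infer_instance

/-- The comparison map `x ⊗ z ⟶ hom(y, z)` for an exact pairing of `x` and `y`. -/
def pairingComparison (x y z : C) [ExactPairing x y] : x ⊗ z ⟶ (ihom y).obj z :=
  curry ((α_ y x z).inv ≫ ε_ x y ▷ z ≫ (λ_ z).hom)

instance isIso_pairingComparison (x y z : C) [ExactPairing x y] :
    IsIso (pairingComparison x y z) := by
  refine isIso_of_yoneda_map_bijective _ fun r => ?_
  have h := ((tensorLeftHomEquiv r x y z).symm.trans
    ((ihom.adjunction y).homEquiv r z)).bijective
  convert h using 2 with a
  apply uncurry_injective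
  simp only [Equiv.trans_apply]
  change _ = uncurry (curry _)
  rw [uncurry_natural_left, pairingComparison, uncurry_curry, uncurry_curry]
  rfl

lemma pairingComparison_comp_evalAt (x y z : C) [ExactPairing x y] (g : 𝟙_ C ⟶ y) :
    pairingComparison x y z ≫ evalAt g z =
      ((λ_ x).inv ≫ g ▷ x ≫ ε_ x y) ▷ z ≫ (λ_ z).hom := by
  rw [comp_evalAt, pairingComparison, uncurry_curry]
  monoidal

end

section

open Functor.LaxMonoidal Functor.OplaxMonoidal

variable {D : Type u₁} {C : Type u₂} [Category.{v} D] [Category.{v} C]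
  [MonoidalCategory D] [MonoidalCategory C] [MonoidalClosed D] [MonoidalClosed C]
  (fstar : D ⥤ C) [fstar.Monoidal] (fpush : C ⥤ D) (adj1 : fstar ⊣ fpush)
  (fone : D ⥤ C) (adj2 : fpush ⊣ fone)

/-- The canonical map `f_* hom(y, f^(1) d) ⟶ hom(f_* y, d)`. -/
def dualityMap (y : C) (d : D) :
    fpush.obj ((ihom y).obj (fone.obj d)) ⟶ (ihom (fpush.obj y)).obj d :=
  curry (projFormulaRight fstar fpush adj1 y _ ≫
    fpush.map (y ◁ adj1.counit.app _ ≫ (ihom.ev y).app (fone.obj d)) ≫ adj2.counit.app d)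

lemma uncurry_comp_dualityMap (y : C) (d : D) {t : D}
    (a : t ⟶ fpush.obj ((ihom y).obj (fone.obj d))) :
    uncurry (a ≫ dualityMap fstar fpush adj1 fone adj2 y d) =
      projFormulaRight fstar fpush adj1 y t ≫
        (adj2.homEquiv _ _).symm (uncurry ((adj1.homEquiv _ _).symm a)) := by
  rw [uncurry_natural_left, dualityMap, uncurry_curry,
    ← Category.assoc, projFormulaRight_naturality]
  simp [Adjunction.homEquiv_counit, uncurry_eq]

lemma bijective_comp_dualityMap (y : C) (d : D) (s t : D) [ExactPairing s t] :
    Function.Bijective (fun a : t ⟶ fpush.obj ((ihom y).obj (fone.obj d)) =>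
      a ≫ dualityMap fstar fpush adj1 fone adj2 y d) := by
  have := isIso_projFormulaRight fstar fpush adj1 y s t
  have h := ((adj1.homEquiv t ((ihom y).obj (fone.obj d))).symm.trans
    (((ihom.adjunction y).homEquiv _ _).symm.trans
    ((adj2.homEquiv _ _).symm.trans
    ((Iso.homFromEquiv (asIso (projFormulaRight fstar fpush adj1 y t)).symm).trans
      ((ihom.adjunction (fpush.obj y)).homEquiv _ _))))).bijective
  convert h using 2 with a
  apply uncurry_injective
  rw [uncurry_comp_dualityMap]
  exact (uncurry_curry _).symm

lemma map_evalAt_comp_counit {y : C} (g : 𝟙_ C ⟶ y) (d : D) :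
    fpush.map (evalAt g (fone.obj d)) ≫ adj2.counit.app d =
      dualityMap fstar fpush adj1 fone adj2 y d ≫
        evalAt (adj1.homEquiv _ _ (η fstar ≫ g)) d := by
  rw [comp_evalAt, dualityMap, uncurry_curry,
    reassoc_of% homEquiv_whiskerRight_comp_projFormulaRight fstar fpush adj1 g]
  rw [← Category.assoc, ← adj1.homEquiv_naturality_right]
  congr 1
  apply (adj1.homEquiv _ _).symm.injective
  refine Eq.trans ?_ (Equiv.symm_apply_apply _ _).symm
  rw [Adjunction.homEquiv_counit, Adjunction.counit_naturality,
    comp_evalAt, uncurry_eq]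
  simp

end

lemma isCompactObj_ihom_tensorUnit {C : Type u} [Category.{v} C] [HasZeroObject C]
    [Preadditive C] [HasBinaryProducts C] [MonoidalCategory C] [BraidedCategory C] [MonoidalClosed C]
    (hC : RigidlyCompactlyGenerated C) {x : C} (hx : IsCompactObj x) :
    IsCompactObj ((ihom x).obj (𝟙_ C)) :=
  let := ((hC.compact_iff_rigid x).1 hx).exactPairing
  let : ExactPairing x ((ihom x).obj (𝟙_ C)) := BraidedCategory.exactPairing_swap _ x
  isCompactObj_of_exactPairing ((hC.compact_iff_rigid _).2 isRigid_tensorUnit) x _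

lemma isIso_curry_rightUnitor_of_bijective {C : Type u} [Category.{v} C] [HasZeroObject C]
    [Preadditive C] [HasShift C ℤ] [∀ n : ℤ, (shiftFunctor C n).Additive] [Pretriangulated C]
    [MonoidalCategory C] [BraidedCategory C] [MonoidalClosed C]
    (hC : RigidlyCompactlyGenerated C) (w : C)
    (hw : ∀ y : C, IsCompactObj y → Function.Bijective (fun g : 𝟙_ C ⟶ y => evalAt g w)) :
    IsIso (curry (ρ_ w).hom) := by
  obtain ⟨ι, G, hG, hG0⟩ := hC.exists_generators
  refine isIso_of_bijective_comp hG hG0 _ fun x hx => ?_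
  let := ((hC.compact_iff_rigid x).1 hx).exactPairing
  let y := (ihom x).obj (𝟙_ C)
  let : ExactPairing x y := BraidedCategory.exactPairing_swap y x
  have hy : IsCompactObj y := isCompactObj_ihom_tensorUnit hC hx
  refine (Function.Bijective.of_comp_iff _ (exactPairing_bijective x y)).1 ?_
  have h := ((Equiv.ofBijective _ (hw y hy)).trans
    ((Iso.homFromEquiv (asIso (pairingComparison x y w)).symm).trans
      ((Iso.homFromEquiv (β_ x w)).trans ((ihom.adjunction w).homEquiv x w)))).bijective
  convert h using 1
  ext g
  apply uncurry_injective
  simp only [Function.comp_apply, Equiv.trans_apply]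
  refine Eq.trans ?_ (uncurry_curry _).symm
  simp only [Iso.homFromEquiv_apply, Iso.symm_inv, asIso_hom, Equiv.ofBijective_apply,
    pairingComparison_comp_evalAt, uncurry_natural_left, uncurry_curry]
  rw [← BraidedCategory.braiding_inv_naturality_right_assoc, braiding_inv_tensorUnit_left]
  simp

lemma tensorInvertible_of_isRigid {C : Type u} [Category.{v} C]
    [MonoidalCategory C] [BraidedCategory C] [MonoidalClosed C]
    {w : C} (hw : IsRigid w) [IsIso (curry (ρ_ w).hom)] : TensorInvertible w :=
  haveI := hw w
  ⟨_, ⟨β_ w ((ihom w).obj (𝟙_ C)) ≪≫ asIso (rigidComparison w w) ≪≫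
    (asIso (curry (ρ_ w).hom)).symm⟩⟩

section

variable {D : Type u₁} {C : Type u₂} [Category.{v} D] [Category.{v} C]
  [HasZeroObject D] [Preadditive D] [HasShift D ℤ] [∀ n : ℤ, (shiftFunctor D n).Additive]
  [Pretriangulated D]
  [MonoidalCategory D] [MonoidalCategory C] [MonoidalClosed D] [MonoidalClosed C]

lemma isIso_dualityMap (fstar : D ⥤ C) [fstar.Monoidal] (fpush : C ⥤ D) (adj1 : fstar ⊣ fpush)
    (fone : D ⥤ C) (adj2 : fpush ⊣ fone)
    (hD : RigidlyCompactlyGenerated D) (y : C) (d : D) :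
    IsIso (dualityMap fstar fpush adj1 fone adj2 y d) := by
  obtain ⟨ι, G, hG, hG0⟩ := hD.exists_generators
  refine isIso_of_bijective_comp hG hG0 _ fun t ht => ?_
  let := ((hD.compact_iff_rigid t).1 ht).exactPairing
  exact bijective_comp_dualityMap fstar fpush adj1 fone adj2 y d ((ihom t).obj (𝟙_ D)) t

lemma bijective_evalAt (fstar : D ⥤ C) [fstar.Monoidal] (fpush : C ⥤ D) (adj1 : fstar ⊣ fpush)
    (fone : D ⥤ C) (adj2 : fpush ⊣ fone)
    (hD : RigidlyCompactlyGenerated D) {y : C}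
    (hy : IsRigid (fpush.obj y)) :
    Function.Bijective (fun g : 𝟙_ C ⟶ y => evalAt g (fone.obj (𝟙_ D))) := by
  have := isIso_dualityMap fstar fpush adj1 fone adj2 hD y (𝟙_ D)
  let := hy.exactPairing
  refine (Function.Bijective.of_comp_iff' (adj2.homEquiv _ (𝟙_ D)).symm.bijective _).1 ?_
  have h := ((Iso.homFromEquiv (Functor.Monoidal.εIso fstar)).trans
    ((adj1.homEquiv _ _).trans
    ((Equiv.ofBijective _ (exactPairing_bijective ((ihom (fpush.obj y)).obj (𝟙_ D))
      (fpush.obj y))).trans (Iso.homFromEquiv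
      (asIso (dualityMap fstar fpush adj1 fone adj2 y (𝟙_ D))).symm)))).bijective
  convert h using 1
  ext g
  exact (adj2.homEquiv_counit _ _ _).trans
    (map_evalAt_comp_counit fstar fpush adj1 fone adj2 g (𝟙_ D))

end

/-- Proposition 4.1. -/
theorem statement8 {D : Type u₁} {C : Type u₂}
    [Category.{v} D] [Preadditive D] [HasZeroObject D] [HasShift D ℤ]
    [∀ n : ℤ, (shiftFunctor D n).Additive] [Pretriangulated D] [IsTriangulated D]
    [MonoidalCategory D] [SymmetricCategory D] [MonoidalClosed D]
    [Category.{v} C] [Preadditive C] [HasZeroObject C] [HasShift C ℤ]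
    [∀ n : ℤ, (shiftFunctor C n).Additive] [Pretriangulated C] [IsTriangulated C]
    [MonoidalCategory C] [SymmetricCategory C] [MonoidalClosed C]
    (fstar : D ⥤ C) [fstar.Braided] [fstar.CommShift ℤ] [fstar.IsTriangulated]
    (hD : RigidlyCompactlyGenerated D) (hC : RigidlyCompactlyGenerated C)
    (hcop : PreservesCoproducts fstar)
    (fpush : C ⥤ D) (adj1 : fstar ⊣ fpush)
    (fone : D ⥤ C) (adj2 : fpush ⊣ fone)
    (hGN : ∀ x : C, IsCompactObj x → IsCompactObj (fpush.obj x)) :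
    IsCompactObj (fpush.obj (fone.obj (𝟙_ D))) ∧
    (IsCompactObj (fone.obj (𝟙_ D)) ↔ TensorInvertible (fone.obj (𝟙_ D))) := by
  have hunit : IsCompactObj (𝟙_ C) := (hC.compact_iff_rigid _).2 isRigid_tensorUnit
  refine ⟨?_, fun h => ?_, isCompactObj_of_tensorInvertible hunit⟩
  · have := isIso_dualityMap fstar fpush adj1 fone adj2 hD (𝟙_ C) (𝟙_ D)
    exact isCompactObj_of_iso
      (fpush.mapIso (asIso (evalAt (𝟙 (𝟙_ C)) (fone.obj (𝟙_ D)))).symm ≪≫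
        asIso (dualityMap fstar fpush adj1 fone adj2 (𝟙_ C) (𝟙_ D)))
      (isCompactObj_ihom_tensorUnit hD (hGN _ hunit))
  · have := isIso_curry_rightUnitor_of_bijective hC (fone.obj (𝟙_ D)) fun y hy =>
      bijective_evalAt fstar fpush adj1 fone adj2 hD ((hD.compact_iff_rigid _).1 (hGN y hy))
    exact tensorInvertible_of_isRigid ((hC.compact_iff_rigid _).1 h)

end GN
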